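/- Let f : X → T be a surjective projective morphism of varieties over an uncountable algebraically closed field k such that T is not uniruled and the geometric generic fiber of f is integral. If X is uniruled, then the geometric generic fiber of f is uniruled. -/

import Mathlib

open CategoryTheory AlgebraicGeometry Limits

noncomputable section

/-- A scheme `X` over a base `S` (with structure morphism `sX`) is *uniruled* if there is an
integral scheme `W` over `S`, locally of finite type, with `dim W + 1 = dim X`, together with
a dominant `S`-rational map `W ×_S 𝔸¹_S ⤏ X`, i.e. an `S`-morphism to `X` from a dense open
subscheme of `W ×_S 𝔸¹_S` with dense image.  (A dominant rational map from `W × ℙ¹` exists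
iff one from `W × 𝔸¹` does, by restricting to/extending over the dense open `𝔸¹ ⊆ ℙ¹`.) -/
def IsUniruled {S X : Scheme} (sX : X ⟶ S) : Prop :=
  ∃ (W : Scheme) (sW : W ⟶ S), IsIntegral W ∧ LocallyOfFiniteType sW ∧
    topologicalKrullDim W + 1 = topologicalKrullDim X ∧
    ∃ f : (pullback sW (AffineSpace (Fin 1) S ↘ S)).PartialMap X,
      DenseRange f.hom.base ∧
      f.hom ≫ sX = f.domain.ι ≫ pullback.fst sW (AffineSpace (Fin 1) S ↘ S) ≫ sW

/-- The canonical morphism `Spec 𝑘(η)^{alg} ⟶ T` from the spectrum of an algebraic closure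
of the residue field at the generic point `η` of an integral scheme `T`; base change along
this morphism produces the geometric generic fiber. -/
def geometricGenericPoint (T : Scheme) [IsIntegral T] :
    Spec (CommRingCat.of (AlgebraicClosure (T.residueField (genericPoint T)))) ⟶ T :=
  Spec.map (CommRingCat.ofHom
      (algebraMap (T.residueField (genericPoint T))
        (AlgebraicClosure (T.residueField (genericPoint T))))) ≫
    T.fromSpecResidueField (genericPoint T)

/-- The elements of a field algebraic over a domain, as a subfield. -/
def algebraicSubfield (R N : Type*) [CommRing R] [IsDomain R] [Field N] [Algebra R N]
    [FaithfulSMul R N] : Subfield N where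
  carrier := {x | IsAlgebraic R x}
  mul_mem' := IsAlgebraic.mul
  add_mem' := IsAlgebraic.add
  one_mem' := isAlgebraic_one
  zero_mem' := isAlgebraic_zero
  neg_mem' := IsAlgebraic.neg
  inv_mem' _ := IsAlgebraic.inv

theorem isAlgebraic_of_forall_isAlgebraic {R F N : Type*} [CommRing R] [IsDomain R] [CommRing F]
    [Field N] [Algebra R N] [FaithfulSMul R N] [Algebra F N] [FaithfulSMul F N]
    (h : ∀ y : F, IsAlgebraic R (algebraMap F N y)) {x : N} (hx : IsAlgebraic F x) :
    IsAlgebraic R x := by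
  let K := algebraicSubfield R N
  let g : F →+* K := (algebraMap F N).codRestrict K h
  let _ : Algebra F K := g.toAlgebra
  have : IsScalarTower F K N := .of_algebraMap_eq fun _ ↦ rfl
  have hg : Function.Injective (algebraMap F K) :=
    fun a b hab ↦ FaithfulSMul.algebraMap_injective F N (congrArg Subtype.val hab)
  let i : R →+* K := (algebraMap R N).codRestrict K (fun r ↦ isAlgebraic_algebraMap r)
  let _ : Algebra R K := i.toAlgebra
  have : IsScalarTower R K N := .of_algebraMap_eq fun _ ↦ rfl
  have : Algebra.IsAlgebraic R K := ⟨fun y ↦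
    (isAlgebraic_algebraMap_iff (A := N) K.subtype_injective).mp y.2⟩
  exact (hx.extendScalars hg).restrictScalars R

theorem isAlgebraic_of_mem_adjoin {R F N : Type*} [CommRing R] [IsDomain R] [Field F]
    [Field N] [Algebra R N] [FaithfulSMul R N] [Algebra F N] {S : Set N}
    (h : ∀ y : F, IsAlgebraic R (algebraMap F N y)) (hS : ∀ x ∈ S, IsAlgebraic R x) {x : N}
    (hx : x ∈ IntermediateField.adjoin F S) : IsAlgebraic R x := by
  have := IntermediateField.adjoin_le_subfield (F := F) (S := S) (K := algebraicSubfield R N)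
    (by rintro _ ⟨y, rfl⟩; exact h y) hS
  exact this hx

/-- For a finitely generated domain `A` over a field `k`, this says that `Spec A` is uniruled:
some algebraic extension `N` of `Frac A` contains a finite set `s` and an element `t`
transcendental over `k(s)` with `A ⊆ k(s, t)`. -/
def IsUniruledAlgebra (k A : Type) [Field k] [CommRing A] [Algebra k A] : Prop :=
  ∃ (N : Type) (_ : Field N) (_ : Algebra k N) (_ : Algebra A N) (s : Set N) (t : N),
    IsScalarTower k A N ∧ FaithfulSMul A N ∧ Algebra.IsAlgebraic A N ∧ s.Finite ∧
    (∀ a : A, algebraMap A N a ∈ IntermediateField.adjoin k (insert t s)) ∧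
    Transcendental (IntermediateField.adjoin k s) t

open TensorProduct in
theorem isUniruledAlgebra_tensorProduct {k R A Ω N : Type} [Field k] [CommRing R] [CommRing A]
    [IsDomain A] [Field Ω] [Algebra k R] [Algebra R A] [Algebra k A] [IsScalarTower k R A]
    [Algebra R Ω] [FaithfulSMul R Ω] [Algebra.IsAlgebraic R Ω] [IsDomain (Ω ⊗[R] A)]
    [FaithfulSMul R A]
    [Field N] [Algebra k N] [Algebra A N] [IsScalarTower k A N] [FaithfulSMul A N]
    [Algebra.IsAlgebraic A N] {s : Set N} {t : N} (hs : s.Finite)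
    (hA : ∀ a : A, algebraMap A N a ∈ IntermediateField.adjoin k (insert t s))
    (ht : Transcendental (IntermediateField.adjoin k s) t)
    (hR : ∀ r : R, IsAlgebraic (IntermediateField.adjoin k s) (algebraMap A N (algebraMap R A r))) :
    IsUniruledAlgebra Ω (Ω ⊗[R] A) := by
  have : IsDomain R := (FaithfulSMul.algebraMap_injective R A).isDomain
  let N' := AlgebraicClosure N
  let _ : Algebra R N' := ((algebraMap A N').comp (algebraMap R A)).toAlgebra
  have : IsScalarTower R A N' := .of_algebraMap_eq fun _ ↦ rfl
  have : FaithfulSMul A N' := .trans A N N'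
  have : FaithfulSMul R N' := .trans R A N'
  let j : Ω →ₐ[R] N' := IsAlgClosed.lift
  let m : Ω ⊗[R] A →ₐ[R] N' := Algebra.TensorProduct.lift j (IsScalarTower.toAlgHom R A N')
    (fun _ _ ↦ Commute.all _ _)
  let _ : Algebra Ω N' := j.toRingHom.toAlgebra
  let _ : Algebra (Ω ⊗[R] A) N' := m.toRingHom.toAlgebra
  let _ : Algebra A (Ω ⊗[R] A) := Algebra.TensorProduct.rightAlgebra
  have hmA : ∀ a, m (1 ⊗ₜ a) = algebraMap A N' a := fun a ↦ by simp [m]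
  have hmΩ : ∀ a, m (a ⊗ₜ 1) = j a := fun a ↦ by simp [m]
  have : IsScalarTower A (Ω ⊗[R] A) N' := .of_algebraMap_eq fun a ↦ (hmA a).symm
  have : IsScalarTower R Ω N' := .of_algebraMap_eq fun a ↦ (j.commutes a).symm
  let e : A ⊗[R] Ω ≃ₐ[A] Ω ⊗[R] A :=
    { Algebra.TensorProduct.comm R A Ω with commutes' := fun _ ↦ rfl }
  have : Algebra.IsAlgebraic A (Ω ⊗[R] A) := e.isAlgebraic
  have hinj : Function.Injective m :=
    Algebra.IsAlgebraic.injective_tower_top (S := Ω ⊗[R] A)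
      (FaithfulSMul.algebraMap_injective A N')
  have : Algebra.IsAlgebraic A N' := .trans A N N'
  have hjs : ∀ y ∈ IntermediateField.adjoin k (insert t s), algebraMap N N' y ∈
      IntermediateField.adjoin Ω (insert (algebraMap N N' t) (algebraMap N N' '' s)) := by
    refine IntermediateField.adjoin_le_subfield (F := k) (S := insert t s)
      (K := Subfield.comap (algebraMap N N')
      (IntermediateField.adjoin Ω (insert (algebraMap N N' t) (algebraMap N N' '' s))).toSubfield)
      ?_ ?_
    · rintro _ ⟨y, rfl⟩
      have : algebraMap N N' (algebraMap k N y) =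
          algebraMap Ω N' (algebraMap R Ω (algebraMap k R y)) := by
        rw [← IsScalarTower.algebraMap_apply R Ω, IsScalarTower.algebraMap_apply R A,
          ← IsScalarTower.algebraMap_apply k R, IsScalarTower.algebraMap_apply k A N,
          ← IsScalarTower.algebraMap_apply A N]
      simp only [Subfield.coe_comap, Set.mem_preimage, this]
      exact IntermediateField.algebraMap_mem _ _
    · intro x hx
      exact IntermediateField.subset_adjoin _ _ (by
        rw [← Set.image_insert_eq]; exact Set.mem_image_of_mem _ hx)
  have : FaithfulSMul A (Ω ⊗[R] A) := .tower_bot A (Ω ⊗[R] A) N'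
  refine ⟨N', inferInstance, inferInstance, inferInstance, algebraMap N N' '' s, algebraMap N N' t,
    .of_algebraMap_eq fun a ↦ (hmΩ a).symm, (faithfulSMul_iff_algebraMap_injective _ _).mpr hinj,
    Algebra.IsAlgebraic.extendScalars (R := A) (FaithfulSMul.algebraMap_injective A (Ω ⊗[R] A)),
    hs.image _, ?_, ?_⟩
  · intro x
    induction x with
    | zero => simp
    | add x y hx hy => rw [map_add]; exact add_mem hx hy
    | tmul x a =>
      have : algebraMap (Ω ⊗[R] A) N' (x ⊗ₜ a) = algebraMap Ω N' x * algebraMap A N' a := by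
        simp [RingHom.algebraMap_toAlgebra, m]
      rw [this]
      refine mul_mem (IntermediateField.algebraMap_mem _ _) ?_
      rw [IsScalarTower.algebraMap_apply A N N']
      exact hjs _ (hA a)
  · intro halg
    refine ht <| (isAlgebraic_algebraMap_iff (A := N') (algebraMap N N').injective).mp ?_
    refine isAlgebraic_of_forall_isAlgebraic (fun y ↦ ?_) halg
    refine isAlgebraic_of_mem_adjoin (F := Ω) (fun z ↦ ?_) ?_ y.2
    · refine isAlgebraic_of_forall_isAlgebraic (F := R) (fun r ↦ ?_)
        ((Algebra.IsAlgebraic.isAlgebraic (R := R) z).algebraMap)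
      rw [IsScalarTower.algebraMap_apply R A, IsScalarTower.algebraMap_apply A N N']
      exact (hR r).algebraMap
    · rintro _ ⟨x, hx, rfl⟩
      exact isAlgebraic_algebraMap
        (⟨x, IntermediateField.subset_adjoin _ _ hx⟩ : IntermediateField.adjoin k s)
        |>.algebraMap

theorem exists_ringHom_integral_of_isAlgClosed {R D Ω : Type*} [CommRing R] [CommRing D]
    [Algebra R D]
    [FaithfulSMul R D] [Algebra.IsIntegral R D] [Field Ω] [IsAlgClosed Ω] (φ : R →+* Ω) :
    ∃ ψ : D →+* Ω, ψ.comp (algebraMap R D) = φ := by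
  let P := RingHom.ker φ
  have : P.IsPrime := RingHom.ker_isPrime φ
  obtain ⟨Q, _, _⟩ := Ideal.nonempty_primesOver (S := D) P
  let _ : Algebra (R ⧸ P) Ω := φ.kerLift.toAlgebra
  have : FaithfulSMul (R ⧸ P) Ω :=
    (faithfulSMul_iff_algebraMap_injective _ _).mpr φ.kerLift_injective
  let _ := Ideal.Quotient.algebraOfLiesOver Q P
  have : Algebra.IsIntegral (R ⧸ P) (D ⧸ Q) := inferInstance
  have : Module.IsTorsionFree (R ⧸ P) (D ⧸ Q) :=
    Module.isTorsionFree_iff_faithfulSMul.mpr (Ideal.Quotient.instFaithfulSMul Q P)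
  let l : D ⧸ Q →ₐ[R ⧸ P] Ω := IsAlgClosed.lift
  refine ⟨l.toRingHom.comp (Ideal.Quotient.mk Q), RingHom.ext fun r ↦ ?_⟩
  exact l.commutes (Ideal.Quotient.mk P r)

theorem exists_subalgebra_ringHom_of_isAlgClosed {R N : Type*} [CommRing R] [Field N] [Algebra R N]
    [FaithfulSMul R N] [Algebra.IsAlgebraic R N] {S : Set N} (hS : S.Finite) :
    ∃ a : R, a ≠ 0 ∧ ∀ (Ω : Type) [Field Ω] [IsAlgClosed Ω] (φ : R →+* Ω), φ a ≠ 0 →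
      ∃ (C : Subalgebra R N) (ψ : C →+* Ω), S ⊆ C ∧ ψ.comp (algebraMap R C) = φ := by
  have : IsDomain R := (FaithfulSMul.algebraMap_injective R N).isDomain
  obtain ⟨a, ha, hint⟩ := Algebra.IsAlgebraic.exists_integral_multiples R hS.toFinset
  refine ⟨a, ha, fun Ω _ _ φ hφ ↦ ?_⟩
  let D := integralClosure R N
  have : FaithfulSMul R D := .tower_bot R D N
  obtain ⟨ψ, hψ⟩ := exists_ringHom_integral_of_isAlgClosed (D := D) φ
  let b := algebraMap R D a
  have hb : ∀ y : Submonoid.powers b, IsUnit (IsScalarTower.toAlgHom R D N y) := by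
    rintro ⟨_, n, rfl⟩
    simp only [map_pow]
    refine (IsUnit.mk0 _ ?_).pow n
    simpa [b] using ha
  have hb' : IsUnit (ψ b) := by
    refine IsUnit.mk0 _ ?_
    rwa [show ψ b = φ a from RingHom.congr_fun hψ a]
  let L := Localization.Away b
  let g : L →ₐ[R] N := IsLocalization.liftAlgHom hb
  have hg : Function.Injective g := by
    refine (IsLocalization.lift_injective_iff _).mpr fun x y ↦ ?_
    rw [(IsLocalization.injective L (M := Submonoid.powers b) ?_).eq_iff]
    · exact Subtype.val_injective.eq_iff.symm
    · refine powers_le_nonZeroDivisors_of_noZeroDivisors ?_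
      simpa [b] using ha
  have hgD (d : D) : g (algebraMap D L d) = d := by
    simp [g]
  let e := AlgEquiv.ofInjective g hg
  refine ⟨g.range, (IsLocalization.Away.lift b hb').comp (e.symm : g.range →+* L), ?_, ?_⟩
  · intro x hx
    let d : D := ⟨a • x, hint x (by simpa using hx)⟩
    refine ⟨IsLocalization.mk' L d ⟨b, Submonoid.mem_powers b⟩, ?_⟩
    have h1 : g (algebraMap D L b) * g (IsLocalization.mk' L d ⟨b, Submonoid.mem_powers b⟩)
        = g (algebraMap D L d) := by
      rw [← map_mul, IsLocalization.mk'_spec'_mk]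
    rw [hgD, hgD] at h1
    have ha' : algebraMap R N a ≠ 0 := by simpa using ha
    refine mul_left_cancel₀ ha' ?_
    rw [← Algebra.smul_def a x]
    exact h1
  · ext r
    have : e.symm (algebraMap R g.range r) = algebraMap R L r := e.symm.commutes r
    simp [this, IsScalarTower.algebraMap_apply R D L, ← hψ]

theorem isAlgebraic_adjoin_of_transcendental {k R A N : Type} [Field k] [CommRing R] [CommRing A]
    [Field N] [Algebra k R] [Algebra k A] [Algebra k N] [Algebra R N] [Algebra A N]
    [IsScalarTower k R N] [FaithfulSMul R N] [FaithfulSMul A N]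
    [Algebra.IsAlgebraic A N] {s : Set N} {t : N}
    (hA : ∀ a : A, algebraMap A N a ∈ IntermediateField.adjoin k (insert t s))
    {r : R} (hr : Transcendental (IntermediateField.adjoin k s) (algebraMap R N r)) :
    Algebra.IsAlgebraic (Algebra.adjoin R s) N := by
  have : IsDomain R := (FaithfulSMul.algebraMap_injective R N).isDomain
  set L := IntermediateField.adjoin k s with hL
  have h1 : Algebra.IsAlgebraic (Algebra.adjoin L {t}) N := by
    refine ⟨fun x ↦ isAlgebraic_of_forall_isAlgebraic (F := A) (fun a ↦ ?_)
      (Algebra.IsAlgebraic.isAlgebraic x)⟩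
    refine isAlgebraic_of_mem_adjoin (F := k) (fun y ↦ ?_) ?_ (hA a)
    · exact isAlgebraic_algebraMap (algebraMap L (Algebra.adjoin L {t}) (algebraMap k L y))
    · rintro x (rfl | hx)
      · exact isAlgebraic_algebraMap (⟨x, Algebra.subset_adjoin rfl⟩ : Algebra.adjoin L {x})
      · exact isAlgebraic_algebraMap (algebraMap L (Algebra.adjoin L {t})
          ⟨x, IntermediateField.subset_adjoin _ _ hx⟩)
  have h2 : Algebra.trdeg L N ≤ 1 := by
    simpa using Algebra.IsAlgebraic.trdeg_le_cardinalMk L {t}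
  have h3 : IsTranscendenceBasis L (Subtype.val : ({algebraMap R N r} : Set N) → N) := by
    refine AlgebraicIndependent.isTranscendenceBasis_of_trdeg_le_of_finite ?_ (by simpa using h2)
    exact algebraicIndependent_unique_type_iff.mpr hr
  have h4 := h3.isAlgebraic
  rw [Subtype.range_coe] at h4
  refine ⟨fun x ↦ isAlgebraic_of_forall_isAlgebraic (F := Algebra.adjoin L {algebraMap R N r})
    (fun y ↦ ?_) (h4.isAlgebraic x)⟩
  refine isAlgebraic_of_mem_adjoin (F := L) (fun l ↦ ?_) ?_
    (IntermediateField.algebra_adjoin_le_adjoin _ _ y.2)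
  · refine isAlgebraic_of_mem_adjoin (F := k) (fun c ↦ ?_) (fun c hc ↦ ?_) l.2
    · rw [IsScalarTower.algebraMap_apply k R N]
      exact isAlgebraic_algebraMap (algebraMap R (Algebra.adjoin R s) (algebraMap k R c))
    · exact isAlgebraic_algebraMap (⟨c, Algebra.subset_adjoin hc⟩ : Algebra.adjoin R s)
  · rintro _ rfl
    exact isAlgebraic_algebraMap (algebraMap R (Algebra.adjoin R s) r)

theorem exists_isTranscendenceBasis_trdeg_eq {k R A N : Type} [Field k] [CommRing R] [CommRing A]
    [Field N] [Algebra k R] [Algebra k A] [Algebra k N] [Algebra R N] [Algebra A N]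
    [IsScalarTower k R N] [FaithfulSMul R N] [FaithfulSMul A N]
    [Algebra.IsAlgebraic A N] {s : Set N} {t : N} (hs : s.Finite)
    (hA : ∀ a : A, algebraMap A N a ∈ IntermediateField.adjoin k (insert t s))
    (ht : Transcendental (IntermediateField.adjoin k s) t)
    {r : R} (hr : Transcendental (IntermediateField.adjoin k s) (algebraMap R N r)) :
    ∃ z u : Set N, z ⊆ u ∧ u ⊆ s ∧ IsTranscendenceBasis R (Subtype.val : z → N) ∧
      (∀ x ∈ s, IsAlgebraic (Algebra.adjoin k u) x) ∧
      Algebra.trdeg k R = Cardinal.mk ↥(u \ z) + 1 := by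
  have : IsDomain R := (FaithfulSMul.algebraMap_injective R N).isDomain
  have := isAlgebraic_adjoin_of_transcendental hA hr
  obtain ⟨z, hzs, hz⟩ := exists_isTranscendenceBasis_subset (R := R) s
  have hzk : AlgebraicIndepOn k id z := hz.1.restrictScalars (algebraMap k R).injective
  obtain ⟨u, hzu, hu⟩ := exists_maximal_algebraicIndependent z s hzs hzk
  have hsu : ∀ x ∈ s, IsAlgebraic (Algebra.adjoin k u) x := by
    intro x hx
    by_contra hxu
    have h1 : AlgebraicIndepOn k id (insert x u) := hu.1.1.insert (by rw [Set.image_id]; exact hxu)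
    have h2 := hu.2 ⟨h1, Set.insert_subset hx hu.1.2⟩ (Set.subset_insert x u) (Set.mem_insert x u)
    exact hxu (isAlgebraic_algebraMap (⟨x, Algebra.subset_adjoin h2⟩ : Algebra.adjoin k u))
  have htu : Transcendental (Algebra.adjoin k u) t := by
    intro halg
    refine ht (isAlgebraic_of_forall_isAlgebraic (fun y ↦ ?_) halg)
    exact isAlgebraic_algebraMap (⟨y, IntermediateField.algebra_adjoin_le_adjoin _ _
      (Algebra.adjoin_mono hu.1.2 y.2)⟩ : IntermediateField.adjoin k s)
  have htu' : t ∉ u := fun h ↦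
    htu (isAlgebraic_algebraMap (⟨t, Algebra.subset_adjoin h⟩ : Algebra.adjoin k u))
  have hind : AlgebraicIndepOn k id (insert t u) := hu.1.1.insert (by rw [Set.image_id]; exact htu)
  have halg : Algebra.IsAlgebraic (Algebra.adjoin k (insert t u)) N := by
    refine ⟨fun x ↦ isAlgebraic_of_forall_isAlgebraic (F := A) (fun a ↦ ?_)
      (Algebra.IsAlgebraic.isAlgebraic x)⟩
    refine isAlgebraic_of_mem_adjoin (F := k) (fun y ↦ ?_) ?_ (hA a)
    · exact isAlgebraic_algebraMap (algebraMap k (Algebra.adjoin k (insert t u)) y)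
    · rintro x (rfl | hx)
      · exact isAlgebraic_algebraMap
          (⟨x, Algebra.subset_adjoin (Set.mem_insert x u)⟩ : Algebra.adjoin k (insert x u))
      · exact (hsu x hx).tower_top_of_subalgebra_le (Algebra.adjoin_mono (Set.subset_insert t u))
  have hbasis : IsTranscendenceBasis k (Subtype.val : ↥(insert t u) → N) :=
    isTranscendenceBasis_iff_algebraicIndependent_isAlgebraic.mpr
      ⟨hind, by rwa [Subtype.range_coe]⟩
  refine ⟨z, u, hzu, hu.1.2, hz, hsu, ?_⟩
  have h1 := hbasis.cardinalMk_eq_trdeg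
  rw [Cardinal.mk_insert htu', ← trdeg_add_eq k R, ← hz.cardinalMk_eq_trdeg,
    ← Cardinal.mk_sdiff_add_mk hzu, add_right_comm] at h1
  have hzfin : Cardinal.mk z < Cardinal.aleph0 := (hs.subset hzs).lt_aleph0
  exact (Cardinal.eq_of_add_eq_add_right h1 hzfin).symm

theorem ringKrullDim_eq_of_isIntegral {R S : Type*} [CommRing R] [CommRing S] [Algebra R S]
    [Algebra.IsIntegral R S] (hinj : Function.Injective (algebraMap R S)) :
    ringKrullDim S = ringKrullDim R := by
  apply le_antisymm
  · refine Order.krullDim_le_of_strictMono (PrimeSpectrum.comap (algebraMap R S)) ?_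
    intro p q hpq
    exact Ideal.IsIntegral.comap_lt_comap hpq
  · refine iSup_le fun l ↦ ?_
    have : FaithfulSMul R S := (faithfulSMul_iff_algebraMap_injective R S).mpr hinj
    obtain ⟨P, _, _⟩ := Ideal.nonempty_primesOver (S := S) l.head.asIdeal
    obtain ⟨L, hL, -⟩ := Ideal.exists_ltSeries_of_hasGoingUp l P
    rw [← hL]
    exact le_iSup_of_le L le_rfl

theorem exists_trdeg_eq_and_ringKrullDim_eq (k A : Type*) [Field k] [CommRing A] [IsDomain A]
    [Algebra k A] [Algebra.FiniteType k A] :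
    ∃ n : ℕ, Algebra.trdeg k A = n ∧ ringKrullDim A = n := by
  obtain ⟨n, g, hg, hint⟩ := exists_integral_inj_algHom_of_fg k A
  refine ⟨n, ?_, ?_⟩
  · let := g.toRingHom.toAlgebra
    have : IsScalarTower k (MvPolynomial (Fin n) k) A := .of_algebraMap_eq' g.comp_algebraMap.symm
    have : Algebra.IsIntegral (MvPolynomial (Fin n) k) A := ⟨hint⟩
    have : FaithfulSMul (MvPolynomial (Fin n) k) A :=
      (faithfulSMul_iff_algebraMap_injective _ _).mpr hg
    have h := lift_trdeg_add_eq k (MvPolynomial (Fin n) k) A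
    simpa [trdeg_eq_zero (R := MvPolynomial (Fin n) k) (A := A),
      MvPolynomial.trdeg_of_isDomain] using h.symm
  · let := g.toRingHom.toAlgebra
    have : Algebra.IsIntegral (MvPolynomial (Fin n) k) A := ⟨hint⟩
    rw [ringKrullDim_eq_of_isIntegral (R := MvPolynomial (Fin n) k) hg,
      MvPolynomial.ringKrullDim_of_isNoetherianRing]
    simp

theorem exists_eval_algebraMap_ne_zero {k R σ : Type*} [Field k] [Infinite k]
    [CommRing R] [IsDomain R] [Algebra k R] {p : MvPolynomial σ R} (hp : p ≠ 0) :
    ∃ c : σ → k, MvPolynomial.eval (fun i ↦ algebraMap k R (c i)) p ≠ 0 := by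
  by_contra! h
  refine hp (MvPolynomial.funext_set (fun _ ↦ Set.range (algebraMap k R))
    (fun _ ↦ Set.infinite_range_of_injective (algebraMap k R).injective) fun x hx ↦ ?_)
  choose c hc using fun i ↦ hx i trivial
  obtain rfl : (fun i ↦ algebraMap k R (c i)) = x := funext hc
  simpa using h c

section Specialization

variable {k N Ω : Type*} [Field k] [Field N] [Algebra k N] [Field Ω] [Algebra k Ω]
  {C : Subalgebra k N} (ψ : C →ₐ[k] Ω)

theorem map_inv_eq_inv_map_of_mem {x y : C} (hxy : (y : N) = (x : N)⁻¹) : ψ y = (ψ x)⁻¹ := by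
  by_cases hx : x = 0
  · obtain rfl : y = 0 := Subtype.ext (by simp [hxy, hx])
    simp [hx]
  · have : x * y = 1 := Subtype.ext (by simp [hxy, hx])
    refine eq_inv_of_mul_eq_one_right ?_
    rw [← map_mul, this, map_one]

theorem map_mem_adjoin_of_mem_adjoin {S : Set N} (hS : S ⊆ C) {x : C}
    (hx : (x : N) ∈ Algebra.adjoin k S) :
    ψ x ∈ IntermediateField.adjoin k (ψ '' (Subtype.val ⁻¹' S)) := by
  let E := IntermediateField.adjoin k (ψ '' (Subtype.val ⁻¹' S))
  have h : Algebra.adjoin k S ≤ (E.toSubalgebra.comap ψ).map C.val := by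
    refine Algebra.adjoin_le fun y hy ↦ ⟨⟨y, hS hy⟩, ?_, rfl⟩
    exact IntermediateField.subset_adjoin _ _ ⟨⟨y, hS hy⟩, hy, rfl⟩
  obtain ⟨y, hy, hyx⟩ := h hx
  obtain rfl : y = x := Subtype.ext hyx
  exact hy

theorem isAlgebraic_map_of_isIntegral {u : Set N} (hu : u ⊆ C) {x : C} {l : Algebra.adjoin k u}
    (hl0 : l ≠ 0) (hl : (l : N)⁻¹ ∈ C) (hx : IsIntegral (Algebra.adjoin k u) (l • (x : N))) :
    IsAlgebraic (IntermediateField.adjoin k (ψ '' (Subtype.val ⁻¹' u))) (ψ x) := by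
  let E := IntermediateField.adjoin k (ψ '' (Subtype.val ⁻¹' u))
  let i : Algebra.adjoin k u →ₐ[k] C := Subalgebra.inclusion (Algebra.adjoin_le hu)
  let _ : Algebra (Algebra.adjoin k u) C := i.toRingHom.toAlgebra
  have : IsScalarTower (Algebra.adjoin k u) C N := .of_algebraMap_eq fun _ ↦ rfl
  have hE (a) : ψ (i a) ∈ E := map_mem_adjoin_of_mem_adjoin ψ hu a.2
  have hint : IsIntegral (Algebra.adjoin k u) (i l * x) :=
    (isIntegral_algebraMap_iff (B := N) Subtype.val_injective).mp hx
  have hint' : IsIntegral E (ψ (i l * x)) :=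
    hint.map_of_comp_eq ((ψ.comp i).toRingHom.codRestrict E hE) ψ.toRingHom rfl
  have hinv : ψ ⟨_, hl⟩ = (ψ (i l))⁻¹ := map_inv_eq_inv_map_of_mem ψ rfl
  have hne : ψ (i l) ≠ 0 := by
    intro h0
    have : i l * ⟨_, hl⟩ = 1 := Subtype.ext (mul_inv_cancel₀ fun h ↦ hl0 (Subtype.ext h))
    simpa [h0] using congrArg ψ this
  have : ψ x = algebraMap E Ω ⟨_, hE l⟩⁻¹ * ψ (i l * x) := by
    rw [map_mul, map_inv₀]
    exact (inv_mul_cancel_left₀ hne _).symm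
  rw [this]
  exact isAlgebraic_algebraMap _ |>.mul hint'.isAlgebraic

end Specialization

theorem isUniruledAlgebra_of_transcendental {k R A N : Type} [Field k] [Infinite k] [CommRing R]
    [CommRing A] [Field N] [Algebra k R] [Algebra.FiniteType k R] [Algebra k A] [Algebra k N]
    [Algebra R N] [Algebra A N] [IsScalarTower k R N] [FaithfulSMul R N] [FaithfulSMul A N]
    [Algebra.IsAlgebraic A N] {s : Set N} {t : N} (hs : s.Finite)
    (hA : ∀ a : A, algebraMap A N a ∈ IntermediateField.adjoin k (insert t s))
    (hRN : ∀ r : R, algebraMap R N r ∈ IntermediateField.adjoin k (insert t s))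
    (ht : Transcendental (IntermediateField.adjoin k s) t)
    {r : R} (hr : Transcendental (IntermediateField.adjoin k s) (algebraMap R N r)) :
    IsUniruledAlgebra k R := by
  have : IsDomain R := (FaithfulSMul.algebraMap_injective R N).isDomain
  obtain ⟨z, u, hzu, hus, hz, hsu, htr⟩ := exists_isTranscendenceBasis_trdeg_eq hs hA ht hr
  -- `N` is algebraic over the polynomial ring on `z`
  let R₀ := MvPolynomial z R
  let _ : Algebra R₀ N := (MvPolynomial.aeval (R := R) (Subtype.val : z → N)).toRingHom.toAlgebra
  have : IsScalarTower R R₀ N := .of_algebraMap_eq fun r ↦ (MvPolynomial.aeval_C _ r).symm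
  have hX (i : z) : algebraMap R₀ N (MvPolynomial.X i) = i := MvPolynomial.aeval_X _ i
  have : FaithfulSMul R₀ N := (faithfulSMul_iff_algebraMap_injective _ _).mpr hz.1
  have : Algebra.IsAlgebraic R₀ N := by
    have := hz.isAlgebraic
    rw [Subtype.range_coe] at this
    refine ⟨fun x ↦ isAlgebraic_of_forall_isAlgebraic (F := Algebra.adjoin R z) (fun y ↦ ?_)
      (this.isAlgebraic x)⟩
    have hy : (y : N) ∈ Algebra.adjoin R (Set.range (Subtype.val : z → N)) := by
      rw [Subtype.range_coe]; exact y.2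
    rw [Algebra.adjoin_range_eq_range_aeval] at hy
    obtain ⟨p, hp⟩ := hy
    change IsAlgebraic R₀ (y : N)
    rw [← hp]
    exact isAlgebraic_algebraMap p
  -- the finitely many elements to be specialized
  choose! l hl0 hl using fun x hx ↦ (hsu x hx).exists_integral_multiple
  choose p hp q hq hpq using fun r ↦ IntermediateField.mem_adjoin_iff_div.mp (hRN r)
  obtain ⟨G, hG⟩ := Algebra.FiniteType.out (R := k) (A := R)
  let S : Set N := insert t s ∪ ((fun x ↦ ((l x : Algebra.adjoin k u) : N)⁻¹) '' s ∪
    (fun r ↦ (q r)⁻¹) '' (G : Set R))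
  have hS : S.Finite := (hs.insert t).union ((hs.image _).union (G.finite_toSet.image _))
  obtain ⟨a, ha, hext⟩ := exists_subalgebra_ringHom_of_isAlgClosed (R := R₀) hS
  obtain ⟨c, hc⟩ := exists_eval_algebraMap_ne_zero (k := k) ha
  let Ω := AlgebraicClosure (FractionRing R)
  have : FaithfulSMul R Ω := .trans R (FractionRing R) Ω
  have : IsScalarTower k R Ω := inferInstance
  have : Algebra.IsAlgebraic R (FractionRing R) := IsLocalization.isAlgebraic _ (nonZeroDivisors R)
  have : Algebra.IsAlgebraic R Ω := .trans R (FractionRing R) Ω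
  let φ : R₀ →+* Ω := (algebraMap R Ω).comp (MvPolynomial.eval fun i ↦ algebraMap k R (c i))
  obtain ⟨C₀, ψ₀, hSC, hψ₀⟩ := hext Ω φ (by simpa [φ] using hc)
  have : IsScalarTower k R₀ N := .of_algebraMap_eq fun x ↦ by
    rw [IsScalarTower.algebraMap_apply k R R₀, ← IsScalarTower.algebraMap_apply R R₀ N,
      ← IsScalarTower.algebraMap_apply]
  let C : Subalgebra k N := C₀.restrictScalars k
  have hψR (r : R) : ψ₀ (algebraMap R₀ C₀ (algebraMap R R₀ r)) = algebraMap R Ω r := by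
    rw [← RingHom.comp_apply, hψ₀]
    simp [φ, R₀]
  let ψ : C →ₐ[k] Ω := { ψ₀ with
    commutes' x := by
      refine Eq.trans ?_ (hψR (algebraMap k R x))
      refine congrArg ψ₀ (Subtype.ext ?_)
      change algebraMap k N x = algebraMap R₀ N (algebraMap R R₀ (algebraMap k R x))
      rw [← IsScalarTower.algebraMap_apply R R₀ N, ← IsScalarTower.algebraMap_apply] }
  have hRC (r : R) : algebraMap R N r ∈ C := by
    rw [IsScalarTower.algebraMap_apply R R₀ N]
    exact C₀.algebraMap_mem _
  have hψR' (r : R) : ψ ⟨_, hRC r⟩ = algebraMap R Ω r := by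
    rw [← hψR]
    refine congrArg ψ₀ (Subtype.ext ?_)
    exact IsScalarTower.algebraMap_apply R R₀ N r
  have hzC (i : z) : ψ ⟨i, hSC (.inl (.inr (hus (hzu i.2))))⟩ = algebraMap k Ω (c i) := by
    have h : ψ₀ (algebraMap R₀ C₀ (MvPolynomial.X i)) = algebraMap k Ω (c i) := by
      rw [← RingHom.comp_apply, hψ₀]
      simp [φ, R₀, ← IsScalarTower.algebraMap_apply]
    rw [← h]
    exact congrArg ψ₀ (Subtype.ext (hX i).symm)
  have htsC : insert t s ⊆ (C : Set N) := fun x hx ↦ hSC (.inl hx)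
  let s' : Set Ω := ψ '' (Subtype.val ⁻¹' s)
  let t' : Ω := ψ ⟨t, htsC (Set.mem_insert t s)⟩
  have himage : ψ '' (Subtype.val ⁻¹' (insert t s)) ⊆ insert t' s' := by
    rintro _ ⟨x, rfl | hx, rfl⟩
    · exact .inl rfl
    · exact .inr ⟨x, hx, rfl⟩
  have hmem (r : R) : algebraMap R Ω r ∈ IntermediateField.adjoin k (insert t' s') := by
    let E := IntermediateField.adjoin k (insert t' s')
    have h : Algebra.adjoin k (G : Set R) ≤
        E.toSubalgebra.comap (IsScalarTower.toAlgHom k R Ω) := by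
      refine Algebra.adjoin_le fun g hg ↦ ?_
      have hE {y : C} (hy : (y : N) ∈ Algebra.adjoin k (insert t s)) : ψ y ∈ E :=
        IntermediateField.adjoin.mono k _ _ himage (map_mem_adjoin_of_mem_adjoin ψ htsC hy)
      have hpC : p g ∈ C := Algebra.adjoin_le htsC (hp g)
      have hqC : q g ∈ C := Algebra.adjoin_le htsC (hq g)
      have hqC' : (q g)⁻¹ ∈ C := hSC (.inr (.inr ⟨g, hg, rfl⟩))
      have h1 : (⟨_, hRC g⟩ : C) = ⟨_, hpC⟩ * ⟨_, hqC'⟩ :=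
        Subtype.ext ((hpq g).trans (div_eq_mul_inv _ _))
      change algebraMap R Ω g ∈ E
      rw [← hψR', h1, map_mul, map_inv_eq_inv_map_of_mem ψ (x := ⟨_, hqC⟩) (y := ⟨_, hqC'⟩) rfl]
      exact mul_mem (hE (hp g)) (inv_mem (hE (hq g)))
    exact h (hG ▸ Algebra.mem_top)
  refine ⟨Ω, inferInstance, inferInstance, inferInstance, s', t', inferInstance, inferInstance,
    inferInstance, (hs.preimage Subtype.val_injective.injOn).image _, hmem, fun halg ↦ ?_⟩
  let Y : Set Ω := ψ '' (Subtype.val ⁻¹' (u \ z))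
  have hk (x : k) : IsAlgebraic (Algebra.adjoin k Y) (algebraMap k Ω x) :=
    isAlgebraic_algebraMap (algebraMap k (Algebra.adjoin k Y) x)
  have huY (x) (hx : x ∈ IntermediateField.adjoin k (ψ '' (Subtype.val ⁻¹' u))) :
      IsAlgebraic (Algebra.adjoin k Y) x := by
    refine isAlgebraic_of_mem_adjoin (F := k) hk ?_ hx
    rintro _ ⟨x, hx, rfl⟩
    by_cases hxz : (x : N) ∈ z
    · exact (hzC ⟨x, hxz⟩) ▸ hk _
    · exact isAlgebraic_algebraMap
        (⟨ψ x, Algebra.subset_adjoin ⟨x, ⟨hx, hxz⟩, rfl⟩⟩ : Algebra.adjoin k Y)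
  have hsY : ∀ x ∈ s', IsAlgebraic (Algebra.adjoin k Y) x := by
    rintro _ ⟨x, hx, rfl⟩
    exact isAlgebraic_of_forall_isAlgebraic (fun y ↦ huY _ y.2) <|
      isAlgebraic_map_of_isIntegral ψ (fun y hy ↦ hSC (.inl (.inr (hus hy)))) (hl0 _ hx)
        (hSC (.inr (.inl ⟨x, hx, rfl⟩))) (hl _ hx)
  have htY : IsAlgebraic (Algebra.adjoin k Y) t' :=
    isAlgebraic_of_forall_isAlgebraic
      (fun y ↦ isAlgebraic_of_mem_adjoin (F := k) hk hsY y.2) halg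
  have hΩY : Algebra.IsAlgebraic (Algebra.adjoin k Y) Ω := by
    refine ⟨fun x ↦ isAlgebraic_of_forall_isAlgebraic (F := R) (fun r ↦ ?_)
      (Algebra.IsAlgebraic.isAlgebraic x)⟩
    refine isAlgebraic_of_mem_adjoin (F := k) hk ?_ (hmem r)
    rintro x (rfl | hx)
    exacts [htY, hsY x hx]
  have h1 := Algebra.IsAlgebraic.trdeg_le_cardinalMk k Y
  rw [← trdeg_add_eq k R, trdeg_eq_zero (R := R) (A := Ω), add_zero, htr] at h1
  have h2 : Cardinal.mk Y ≤ Cardinal.mk ↥(u \ z) :=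
    Cardinal.mk_image_le.trans (Cardinal.mk_preimage_of_injective _ _ Subtype.val_injective)
  have h3 : Cardinal.mk ↥(u \ z) < Cardinal.aleph0 :=
    (hs.subset (Set.sdiff_subset.trans hus)).lt_aleph0
  have h4 := h1.trans h2
  obtain ⟨n, hn⟩ := Cardinal.lt_aleph0.mp h3
  rw [hn] at h4
  norm_cast at h4
  omega

open TensorProduct in
theorem IsUniruledAlgebra.or_tensorProduct {k R A Ω : Type} [Field k] [Infinite k] [CommRing R]
    [CommRing A] [IsDomain A] [Field Ω] [Algebra k R] [Algebra.FiniteType k R] [Algebra R A]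
    [Algebra k A] [IsScalarTower k R A] [FaithfulSMul R A] [Algebra R Ω] [FaithfulSMul R Ω]
    [Algebra.IsAlgebraic R Ω] [IsDomain (Ω ⊗[R] A)] (h : IsUniruledAlgebra k A) :
    IsUniruledAlgebra k R ∨ IsUniruledAlgebra Ω (Ω ⊗[R] A) := by
  obtain ⟨N, _, _, _, s, t, _, _, _, hs, hA, ht⟩ := h
  by_cases hR : ∀ r : R,
      IsAlgebraic (IntermediateField.adjoin k s) (algebraMap A N (algebraMap R A r))
  · exact .inr (isUniruledAlgebra_tensorProduct hs hA ht hR)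
  · push Not at hR
    obtain ⟨r, hr⟩ := hR
    let _ : Algebra R N := ((algebraMap A N).comp (algebraMap R A)).toAlgebra
    have : IsScalarTower R A N := .of_algebraMap_eq fun _ ↦ rfl
    have : FaithfulSMul R N := .trans R A N
    have : IsScalarTower k R N := .of_algebraMap_eq fun x ↦ by
      rw [IsScalarTower.algebraMap_apply R A N, ← IsScalarTower.algebraMap_apply k R A,
        ← IsScalarTower.algebraMap_apply]
    exact .inl (isUniruledAlgebra_of_transcendental hs hA (fun r ↦ hA _) ht hr)

theorem denseRange_of_isOpenImmersion {U Y : Scheme} [PreirreducibleSpace Y] [Nonempty U]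
    (i : U ⟶ Y) [IsOpenImmersion i] : DenseRange i :=
  i.isOpenEmbedding.isOpen_range.dense (Set.range_nonempty _)

theorem preirreducibleSpace_of_isOpenImmersion {U Y : Scheme} [PreirreducibleSpace Y]
    (i : U ⟶ Y) [IsOpenImmersion i] : PreirreducibleSpace U := by
  refine ⟨fun V W hV hW ⟨x, _, hx⟩ ⟨y, _, hy⟩ => ?_⟩
  obtain ⟨z, -, ⟨a, ha, rfl⟩, b, hb, hab⟩ := PreirreducibleSpace.isPreirreducible_univ (X := Y)
    (i '' V) (i '' W) (i.isOpenEmbedding.isOpenMap _ hV) (i.isOpenEmbedding.isOpenMap _ hW)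
    ⟨i x, trivial, Set.mem_image_of_mem _ hx⟩ ⟨i y, trivial, Set.mem_image_of_mem _ hy⟩
  obtain rfl := i.isOpenEmbedding.injective hab
  exact ⟨b, trivial, ha, hb⟩

theorem injective_of_denseRange_specMap {A B : Type} [CommRing A] [IsReduced A] [CommRing B]
    (φ : A →+* B) (h : DenseRange (Spec.map (CommRingCat.ofHom φ))) : Function.Injective φ := by
  have := (PrimeSpectrum.denseRange_comap_iff_ker_le_nilRadical φ).1 h
  rw [nilradical_eq_zero A] at this
  exact (RingHom.injective_iff_ker_eq_bot φ).2 (le_bot_iff.1 this)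

theorem denseRange_of_comp_isOpenImmersion {Z Y X : Scheme} (a : Z ⟶ Y) (j : Y ⟶ X)
    [IsOpenImmersion j] (h : DenseRange (a ≫ j)) : DenseRange a := by
  intro p
  rw [mem_closure_iff]
  intro O hO hp
  obtain ⟨_, ⟨q, hq, hq'⟩, ⟨r, rfl⟩⟩ := h.inter_open_nonempty (j '' O)
    (j.isOpenEmbedding.isOpenMap _ hO) ⟨j p, p, hp, rfl⟩
  refine ⟨_, ?_, ⟨r, rfl⟩⟩
  have : q = a r := by
    apply j.isOpenEmbedding.injective
    rw [hq']
    rfl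
  exact this ▸ hq

theorem exists_localization_lift {Y X U : Scheme} [PreirreducibleSpace Y] (u : U ⟶ Y)
    [IsOpenImmersion u] (g : U ⟶ X) (hg : DenseRange g) {A B : Type} [CommRing A]
    [IsDomain A] [CommRing B] [IsDomain B] (i : Spec (CommRingCat.of B) ⟶ Y) [IsOpenImmersion i]
    (j : Spec (CommRingCat.of A) ⟶ X) [IsOpenImmersion j] :
    ∃ b : B, b ≠ 0 ∧ ∃ (φ : A →+* Localization.Away b)
      (l : Spec (CommRingCat.of (Localization.Away b)) ⟶ U), Function.Injective φ ∧
      l ≫ u = Spec.map (CommRingCat.ofHom (algebraMap B (Localization.Away b))) ≫ i ∧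
      Spec.map (CommRingCat.ofHom φ) ≫ j = l ≫ g := by
  obtain ⟨x, ⟨⟨a, rfl⟩⟩⟩ : (Set.range g ∩ Set.range j).Nonempty := by
    rw [Set.inter_comm]
    exact hg.inter_open_nonempty _ j.isOpenEmbedding.isOpen_range (Set.range_nonempty _)
  let V : Y.Opens := u ''ᵁ (g ⁻¹ᵁ j.opensRange)
  have hV : (i ⁻¹ᵁ V : Set (Spec (CommRingCat.of B))).Nonempty := by
    obtain ⟨_, hy, ⟨y, rfl⟩⟩ := (denseRange_of_isOpenImmersion i).inter_open_nonempty V V.isOpen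
      ⟨u a, a, ‹_›, rfl⟩
    exact ⟨y, hy⟩
  obtain ⟨y, hy⟩ := hV
  obtain ⟨_, ⟨b, rfl⟩, hyb, hb⟩ :=
    PrimeSpectrum.isTopologicalBasis_basic_opens.exists_subset_of_mem_open hy (i ⁻¹ᵁ V).isOpen
  have hb0 : b ≠ 0 := by
    rintro rfl
    simp at hyb
    exact hyb
  refine ⟨b, hb0, ?_⟩
  let c := Spec.map (CommRingCat.ofHom (algebraMap B (Localization.Away b)))
  have hc : Set.range c = (PrimeSpectrum.basicOpen b : Set (PrimeSpectrum B)) :=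
    PrimeSpectrum.localization_away_comap_range _ b
  have hcV : ∀ z, (c ≫ i) z ∈ V := fun z => hb (hc.subset (Set.mem_range_self z))
  have h1 : Set.range (c ≫ i) ⊆ Set.range u := by
    rintro _ ⟨z, rfl⟩
    obtain ⟨w, -, hw⟩ := hcV z
    exact ⟨w, hw⟩
  let l := IsOpenImmersion.lift u (c ≫ i) h1
  have hl : l ≫ u = c ≫ i := IsOpenImmersion.lift_fac _ _ _
  have h2 : Set.range (l ≫ g) ⊆ Set.range j := by
    rintro _ ⟨z, rfl⟩
    obtain ⟨w, hw, hw'⟩ := hcV z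
    have : w = l z := by
      apply u.isOpenEmbedding.injective
      rw [← Scheme.Hom.comp_apply, hl]
      exact hw'
    subst this
    exact hw
  obtain ⟨φ, hφ⟩ := Spec.map_surjective (IsOpenImmersion.lift j (l ≫ g) h2)
  have hfac : Spec.map φ ≫ j = l ≫ g := by rw [hφ]; exact IsOpenImmersion.lift_fac _ _ _
  refine ⟨φ.hom, l, ?_, hl, hfac⟩
  apply injective_of_denseRange_specMap
  have : IsOpenImmersion (l ≫ u) := hl ▸ inferInstance
  have : IsOpenImmersion l := IsOpenImmersion.of_comp l u
  have := preirreducibleSpace_of_isOpenImmersion u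
  have : Nontrivial (Localization.Away b) :=
    (IsLocalization.injective (Localization.Away b)
      (powers_le_nonZeroDivisors_of_noZeroDivisors hb0)).nontrivial
  have hd : DenseRange (l ≫ g) := by
    rw [show ⇑(l ≫ g) = g ∘ l from funext fun z => Scheme.Hom.comp_apply l g z]
    exact hg.comp (denseRange_of_isOpenImmersion l) g.continuous
  rw [← hfac] at hd
  exact denseRange_of_comp_isOpenImmersion _ j hd

theorem exists_localization_lift_algHom {k : Type} [Field k] {Y X U : Scheme}
    [PreirreducibleSpace Y] {sX : X ⟶ Spec (CommRingCat.of k)} {sY : Y ⟶ Spec (CommRingCat.of k)}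
    (u : U ⟶ Y) [IsOpenImmersion u] (g : U ⟶ X) (hg : DenseRange g) (h : g ≫ sX = u ≫ sY)
    {A B : Type} [CommRing A] [IsDomain A] [CommRing B] [IsDomain B] [Algebra k A] [Algebra k B]
    (i : Spec (CommRingCat.of B) ⟶ Y) [IsOpenImmersion i]
    (hi : i ≫ sY = Spec.map (CommRingCat.ofHom (algebraMap k B)))
    (j : Spec (CommRingCat.of A) ⟶ X) [IsOpenImmersion j]
    (hj : j ≫ sX = Spec.map (CommRingCat.ofHom (algebraMap k A))) :
    ∃ b : B, b ≠ 0 ∧ ∃ φ : A →ₐ[k] Localization.Away b, Function.Injective φ := by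
  obtain ⟨b, hb, φ, l, hφ, hl, hl'⟩ := exists_localization_lift u g hg i j
  have key : Spec.map (CommRingCat.ofHom (φ.comp (algebraMap k A))) =
      Spec.map (CommRingCat.ofHom (algebraMap k (Localization.Away b))) := by
    rw [IsScalarTower.algebraMap_eq k B (Localization.Away b), CommRingCat.ofHom_comp,
      CommRingCat.ofHom_comp,
      Spec.map_comp, Spec.map_comp, ← hi, ← hj, reassoc_of% hl', h, reassoc_of% hl]
  have h2 := congr_arg CommRingCat.Hom.hom (Spec.map_injective key)
  exact ⟨b, hb, { φ with commutes' := fun r => RingHom.congr_fun h2 r }, hφ⟩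

theorem isDomain_of_isOpenImmersion {X : Scheme} [IsIntegral X] {A : Type} [CommRing A]
    [Nontrivial A] (j : Spec (CommRingCat.of A) ⟶ X) [IsOpenImmersion j] : IsDomain A := by
  have : Nonempty (Spec (CommRingCat.of A)) := inferInstanceAs (Nonempty (PrimeSpectrum A))
  have := isIntegral_of_isOpenImmersion j
  exact (affine_isIntegral_iff (CommRingCat.of A)).1 this

theorem finiteType_of_isOpenImmersion {X : Scheme} {R A : Type} [CommRing R] [CommRing A]
    [Algebra R A] {sX : X ⟶ Spec (CommRingCat.of R)} [LocallyOfFiniteType sX]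
    (j : Spec (CommRingCat.of A) ⟶ X) [IsOpenImmersion j]
    (hj : j ≫ sX = Spec.map (CommRingCat.ofHom (algebraMap R A))) : Algebra.FiniteType R A := by
  have : LocallyOfFiniteType (Spec.map (CommRingCat.ofHom (algebraMap R A))) :=
    hj ▸ inferInstance
  exact RingHom.finiteType_algebraMap.1
    ((HasRingHomProperty.Spec_iff (P := @LocallyOfFiniteType)).1 this)

theorem exists_chart_of_mem {X : Scheme} {R : Type} [CommRing R] (sX : X ⟶ Spec (CommRingCat.of R))
    {x : X} {O : X.Opens} (hx : x ∈ O) : ∃ (A : Type) (_ : CommRing A) (_ : Algebra R A)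
      (j : Spec (CommRingCat.of A) ⟶ X), Nontrivial A ∧ IsOpenImmersion j ∧ x ∈ Set.range j ∧
      Set.range j ⊆ O ∧ j ≫ sX = Spec.map (CommRingCat.ofHom (algebraMap R A)) := by
  obtain ⟨A, j, hj, ⟨y, hy⟩, hO⟩ := Scheme.exists_affine_mem_range_and_range_subset hx
  refine ⟨A, inferInstance, (Spec.preimage (j ≫ sX)).hom.toAlgebra, j, ?_, hj, ⟨y, hy⟩, hO, ?_⟩
  · exact PrimeSpectrum.nontrivial (R := A) y
  · rw [RingHom.algebraMap_toAlgebra, CommRingCat.ofHom_hom, Spec.map_preimage]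

open Algebra in
theorem trdeg_eq_of_isAlgebraic (k B C : Type) [Field k] [CommRing B] [CommRing C] [IsDomain C]
    [Algebra k B] [Algebra k C] [Algebra B C] [IsScalarTower k B C] [FaithfulSMul B C]
    [Algebra.IsAlgebraic B C] : trdeg k B = trdeg k C := by
  have : IsDomain B := (FaithfulSMul.algebraMap_injective B C).isDomain
  rw [← trdeg_add_eq k B (A := C), trdeg_eq_zero (R := B) (A := C), add_zero]

theorem trdeg_localization_away (k : Type) {B : Type} [Field k] [CommRing B] [IsDomain B]
    [Algebra k B] {b : B} (hb : b ≠ 0) :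
    Algebra.trdeg k (Localization.Away b) = Algebra.trdeg k B := by
  have h := powers_le_nonZeroDivisors_of_noZeroDivisors hb
  have : FaithfulSMul B (Localization.Away b) :=
    (faithfulSMul_iff_algebraMap_injective _ _).2 (IsLocalization.injective _ h)
  have : IsDomain (Localization.Away b) := IsLocalization.isDomain_localization h
  have : Algebra.IsAlgebraic B (Localization.Away b) :=
    IsLocalization.isAlgebraic _ (Submonoid.powers b)
  exact (trdeg_eq_of_isAlgebraic k B (Localization.Away b)).symm

theorem exists_trdeg_eq_and_topologicalKrullDim_eq {k : Type} [Field k] {X : Scheme} [IsIntegral X]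
    {sX : X ⟶ Spec (CommRingCat.of k)} [LocallyOfFiniteType sX] {A : Type} [CommRing A]
    [Nontrivial A] [Algebra k A] (j : Spec (CommRingCat.of A) ⟶ X) [IsOpenImmersion j]
    (hj : j ≫ sX = Spec.map (CommRingCat.ofHom (algebraMap k A))) :
    ∃ n : ℕ, Algebra.trdeg k A = n ∧ topologicalKrullDim X = n := by
  have := isDomain_of_isOpenImmersion j
  have := finiteType_of_isOpenImmersion j hj
  obtain ⟨n, hn, hdim⟩ := exists_trdeg_eq_and_ringKrullDim_eq k A
  refine ⟨n, hn, le_antisymm ?_ ?_⟩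
  · rw [topologicalKrullDim, Order.krullDim_eq_iSup_coheight]
    refine iSup_le fun Z => ?_
    obtain ⟨x, hx⟩ := Z.isIrreducible.nonempty
    obtain ⟨B, _, _, i, _, _, hxi, -, hi⟩ := exists_chart_of_mem sX (x := x) (O := ⊤) trivial
    have := isDomain_of_isOpenImmersion i
    have := finiteType_of_isOpenImmersion i hi
    obtain ⟨m, hm, hdim'⟩ := exists_trdeg_eq_and_ringKrullDim_eq k B
    have hdense : DenseRange (𝟙 X : X ⟶ X) := by simpa using! denseRange_id
    obtain ⟨b, hb, φ, hφ⟩ := exists_localization_lift_algHom (𝟙 X) (𝟙 X) hdense rfl j hj i hi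
    have hle := trdeg_le_of_injective φ hφ
    rw [trdeg_localization_away k hb, hn, hm, Nat.cast_le] at hle
    obtain ⟨y, rfl⟩ := hxi
    let e := TopologicalSpace.IrreducibleCloseds.orderIsoOfIsOpenEmbedding i i.isOpenEmbedding
    obtain ⟨Z', hZ'⟩ := e.surjective ⟨Z, y, hx⟩
    have hZ'' : TopologicalSpace.IrreducibleCloseds.map i i.continuous Z' = Z :=
      congr_arg Subtype.val hZ'
    rw [← hZ'', Topology.IsOpenEmbedding.coheight_map i.isOpenEmbedding]
    refine (Order.coheight_le_krullDim _).trans ?_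
    change topologicalKrullDim (PrimeSpectrum B) ≤ _
    rw [PrimeSpectrum.topologicalKrullDim_eq_ringKrullDim, hdim']
    exact_mod_cast hle
  · rw [← hdim, ← PrimeSpectrum.topologicalKrullDim_eq_ringKrullDim]
    exact j.isOpenEmbedding.isInducing.topologicalKrullDim_le

theorem trdeg_mvPolynomial_fin_one (k B : Type) [Field k] [CommRing B] [IsDomain B] [Algebra k B] :
    Algebra.trdeg k (MvPolynomial (Fin 1) B) = Algebra.trdeg k B + 1 := by
  rw [← trdeg_add_eq k B (A := MvPolynomial (Fin 1) B), MvPolynomial.trdeg_of_isDomain]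
  simp

theorem isUniruledAlgebra_of_algHom {k A B : Type} [Field k] [CommRing A] [CommRing B]
    [IsDomain B] [Algebra k A] [Algebra k B] [Algebra.FiniteType k B]
    {h : MvPolynomial (Fin 1) B} (hh : h ≠ 0) (φ : A →ₐ[k] Localization.Away h)
    (hφ : Function.Injective φ) (hdim : Algebra.trdeg k B + 1 = Algebra.trdeg k A) :
    IsUniruledAlgebra k A := by
  let P := MvPolynomial (Fin 1) B
  let L := Localization.Away h
  have hpow : Submonoid.powers h ≤ nonZeroDivisors P :=
    powers_le_nonZeroDivisors_of_noZeroDivisors hh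
  have : IsDomain L := IsLocalization.isDomain_localization hpow
  have : FaithfulSMul P L :=
    (faithfulSMul_iff_algebraMap_injective _ _).2 (IsLocalization.injective _ hpow)
  have : Algebra.IsAlgebraic P L := IsLocalization.isAlgebraic _ (Submonoid.powers h)
  let N := FractionRing L
  have : Algebra.IsAlgebraic L N := IsLocalization.isAlgebraic _ (nonZeroDivisors L)
  have : FaithfulSMul P N := .trans P L N
  have : Algebra.IsAlgebraic P N := .trans P L N
  have : IsScalarTower k P N := inferInstance
  have : FaithfulSMul B N := .trans B P N
  let _ : Algebra A N := ((algebraMap L N).comp φ.toRingHom).toAlgebra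
  have : IsScalarTower k A N := .of_algebraMap_eq fun x => by
    change _ = algebraMap L N (φ (algebraMap k A x))
    rw [φ.commutes, ← IsScalarTower.algebraMap_apply]
  have : FaithfulSMul A N := (faithfulSMul_iff_algebraMap_injective _ _).2
    ((IsFractionRing.injective L N).comp hφ)
  have : IsDomain A := (FaithfulSMul.algebraMap_injective A N).isDomain
  have : Algebra.IsAlgebraic A N := by
    rw [← trdeg_eq_zero_iff]
    have h1 := trdeg_eq_of_isAlgebraic k P N
    rw [trdeg_mvPolynomial_fin_one, hdim, ← trdeg_add_eq k A (A := N)] at h1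
    have h2 : Algebra.trdeg k A < Cardinal.aleph0 := by
      rw [← hdim]
      exact Cardinal.add_lt_aleph0 (trdeg_lt_aleph0_of_finiteType ..)
        Cardinal.one_lt_aleph0
    exact Cardinal.eq_of_add_eq_add_left (by rw [add_zero]; exact h1.symm) h2
  obtain ⟨S, hS⟩ := Algebra.FiniteType.out (R := k) (A := B)
  let s : Set N := algebraMap B N '' S
  let t : N := algebraMap P N (MvPolynomial.X 0)
  refine ⟨N, inferInstance, inferInstance, inferInstance, s, t, inferInstance, inferInstance,
    inferInstance, S.finite_toSet.image _, ?_, ?_⟩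
  · let E := IntermediateField.adjoin k (insert t s)
    have hB (b : B) : algebraMap B N b ∈ E := by
      have hb : b ∈ Algebra.adjoin k (S : Set B) := hS ▸ trivial
      induction hb using Algebra.adjoin_induction with
      | mem x hx => exact IntermediateField.subset_adjoin _ _ (.inr ⟨x, hx, rfl⟩)
      | algebraMap r => rw [← IsScalarTower.algebraMap_apply]; exact E.algebraMap_mem r
      | add x y _ _ hx hy => rw [map_add]; exact add_mem hx hy
      | mul x y _ _ hx hy => rw [map_mul]; exact mul_mem hx hy
    have hP (p : P) : algebraMap P N p ∈ E := by
      induction p using MvPolynomial.induction_on with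
      | C b => exact (IsScalarTower.algebraMap_apply B P N b) ▸ hB b
      | add p q hp hq => rw [map_add]; exact add_mem hp hq
      | mul_X p i hp =>
        rw [map_mul, Subsingleton.elim i 0]
        exact mul_mem hp (IntermediateField.subset_adjoin _ _ (.inl rfl))
    have hL (x : L) : algebraMap L N x ∈ E := by
      obtain ⟨⟨p, q⟩, hpq⟩ := IsLocalization.surj (Submonoid.powers h) x
      have h1 := congr_arg (algebraMap L N) hpq
      rw [map_mul, ← IsScalarTower.algebraMap_apply, ← IsScalarTower.algebraMap_apply] at h1
      have hq : algebraMap P N q ≠ 0 := by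
        simpa using nonZeroDivisors.ne_zero (hpow q.2)
      rw [eq_div_of_mul_eq hq h1]
      exact div_mem (hP _) (hP _)
    exact fun a => hL (φ a)
  · intro ht
    have h1 : IsAlgebraic B t := by
      refine isAlgebraic_of_forall_isAlgebraic (F := IntermediateField.adjoin k s) (fun y => ?_) ht
      refine isAlgebraic_of_mem_adjoin (F := k) (S := s) (fun y => ?_) ?_ y.2
      · rw [IsScalarTower.algebraMap_apply k B N]
        exact isAlgebraic_algebraMap _
      · rintro _ ⟨b, -, rfl⟩
        exact isAlgebraic_algebraMap _
    exact MvPolynomial.transcendental_X B (0 : Fin 1)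
      ((isAlgebraic_algebraMap_iff (FaithfulSMul.algebraMap_injective P N)).1 h1)

theorem isIntegral_pullback_affineSpace {S W : Scheme} [IsIntegral W] (sW : W ⟶ S) :
    IsIntegral (pullback sW (AffineSpace (Fin 1) S ↘ S)) := by
  let e : AffineSpace (Fin 1) W ≅ pullback sW (AffineSpace (Fin 1) S ↘ S) :=
    (AffineSpace.isPullback_map (n := Fin 1) sW).flip.isoPullback
  have : Nonempty ↥(pullback sW (AffineSpace (Fin 1) S ↘ S)) := ⟨e.hom (Classical.arbitrary _)⟩
  exact isIntegral_of_isOpenImmersion e.inv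

theorem exists_chart_pullback_affineSpace {R B : Type} [CommRing R] [CommRing B] [Algebra R B]
    {W : Scheme} {sW : W ⟶ Spec (CommRingCat.of R)} (i : Spec (CommRingCat.of B) ⟶ W)
    [IsOpenImmersion i] (hi : i ≫ sW = Spec.map (CommRingCat.ofHom (algebraMap R B))) :
    ∃ i' : Spec (CommRingCat.of (MvPolynomial (Fin 1) B)) ⟶
        pullback sW (AffineSpace (Fin 1) (Spec (CommRingCat.of R)) ↘ Spec (CommRingCat.of R)),
      IsOpenImmersion i' ∧ i' ≫ pullback.fst _ _ ≫ sW =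
        Spec.map (CommRingCat.ofHom (algebraMap R (MvPolynomial (Fin 1) B))) := by
  let e : AffineSpace (Fin 1) W ≅ pullback sW (AffineSpace (Fin 1) (Spec (CommRingCat.of R)) ↘ _) :=
    (AffineSpace.isPullback_map (n := Fin 1) sW).flip.isoPullback
  have he : e.hom ≫ pullback.fst _ _ = AffineSpace (Fin 1) W ↘ W :=
    IsPullback.isoPullback_hom_fst _
  have hmap : IsOpenImmersion (AffineSpace.map (Fin 1) i) :=
    MorphismProperty.of_isPullback (P := @IsOpenImmersion)
      (AffineSpace.isPullback_map (n := Fin 1) i).flip inferInstance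
  refine ⟨(AffineSpace.SpecIso (Fin 1) (CommRingCat.of B)).inv ≫ AffineSpace.map (Fin 1) i ≫ e.hom,
    inferInstance, ?_⟩
  simp only [Category.assoc, reassoc_of% he]
  rw [AffineSpace.map_over_assoc, AffineSpace.SpecIso_inv_over_assoc, hi, ← Spec.map_comp]
  rfl

theorem IsUniruled.isUniruledAlgebra {k : Type} [Field k] {X : Scheme} [IsIntegral X]
    {sX : X ⟶ Spec (CommRingCat.of k)} [LocallyOfFiniteType sX] (hX : IsUniruled sX) {A : Type}
    [CommRing A] [Nontrivial A] [Algebra k A] (j : Spec (CommRingCat.of A) ⟶ X) [IsOpenImmersion j]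
    (hj : j ≫ sX = Spec.map (CommRingCat.ofHom (algebraMap k A))) : IsUniruledAlgebra k A := by
  obtain ⟨W, sW, _, _, hdim, f, hf, hcomp⟩ := hX
  have := isIntegral_pullback_affineSpace sW
  obtain ⟨B, _, _, i, _, _, -, -, hi⟩ :=
    exists_chart_of_mem sW (x := Classical.arbitrary W) (O := ⊤) trivial
  have := isDomain_of_isOpenImmersion i
  have := isDomain_of_isOpenImmersion j
  have := finiteType_of_isOpenImmersion i hi
  obtain ⟨i', _, hi'⟩ := exists_chart_pullback_affineSpace i hi
  obtain ⟨h, hh, φ, hφ⟩ := exists_localization_lift_algHom f.domain.ι f.hom hf hcomp i' hi' j hj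
  refine isUniruledAlgebra_of_algHom hh φ hφ ?_
  obtain ⟨n, hn, hn'⟩ := exists_trdeg_eq_and_topologicalKrullDim_eq j hj
  obtain ⟨m, hm, hm'⟩ := exists_trdeg_eq_and_topologicalKrullDim_eq i hi
  rw [hn', hm'] at hdim
  rw [hn, hm]
  exact_mod_cast hdim

theorem exists_algHom_of_fraction {k A P N : Type} [Field k] [CommRing A] [CommRing P] [IsDomain P]
    [Field N] [Algebra k A] [Algebra k P] [Algebra k N] [Algebra A N] [Algebra P N]
    [IsScalarTower k A N] [IsScalarTower k P N] [FaithfulSMul A N] [FaithfulSMul P N]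
    [Algebra.FiniteType k A]
    (hA : ∀ a : A, ∃ p q : P, q ≠ 0 ∧ algebraMap P N q * algebraMap A N a = algebraMap P N p) :
    ∃ h : P, h ≠ 0 ∧ ∃ φ : A →ₐ[k] Localization.Away h, Function.Injective φ := by
  classical
  choose p q hq hpq using hA
  obtain ⟨S, hS⟩ := Algebra.FiniteType.out (R := k) (A := A)
  let h := ∏ a ∈ S, q a
  have hh : h ≠ 0 := Finset.prod_ne_zero_iff.2 fun a _ => hq a
  have hhN : algebraMap P N h ≠ 0 := by simpa using hh
  have hu : ∀ y : Submonoid.powers h, IsUnit (IsScalarTower.toAlgHom k P N y) := by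
    rintro ⟨_, n, rfl⟩
    simp only [map_pow]
    exact (IsUnit.mk0 _ hhN).pow n
  let L := Localization.Away h
  let g : L →ₐ[k] N := IsLocalization.liftAlgHom hu
  have hgP (x : P) : g (algebraMap P L x) = algebraMap P N x := by simp [g]
  have hg : Function.Injective g := by
    refine (IsLocalization.lift_injective_iff _).mpr fun x y ↦ ?_
    rw [(IsLocalization.injective L (M := Submonoid.powers h)
      (powers_le_nonZeroDivisors_of_noZeroDivisors hh)).eq_iff]
    exact (FaithfulSMul.algebraMap_injective P N).eq_iff.symm
  have hmem (a : A) : IsScalarTower.toAlgHom k A N a ∈ g.range := by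
    have ha : a ∈ Algebra.adjoin k (S : Set A) := hS ▸ trivial
    refine Algebra.adjoin_le (S := g.range.comap (IsScalarTower.toAlgHom k A N)) ?_ ha
    intro a ha
    refine ⟨IsLocalization.mk' L (p a * ∏ b ∈ S.erase a, q b) ⟨h, Submonoid.mem_powers h⟩, ?_⟩
    have h1 : g (algebraMap P L h) * g (IsLocalization.mk' L (p a * ∏ b ∈ S.erase a, q b)
        ⟨h, Submonoid.mem_powers h⟩) = g (algebraMap P L (p a * ∏ b ∈ S.erase a, q b)) := by
      rw [← map_mul, IsLocalization.mk'_spec'_mk]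
    rw [hgP, hgP, map_mul, ← hpq] at h1
    refine mul_left_cancel₀ hhN (h1.trans ?_)
    rw [show h = q a * ∏ b ∈ S.erase a, q b from (Finset.mul_prod_erase S q ha).symm, map_mul]
    simp only [IsScalarTower.coe_toAlgHom]
    ring
  let e := AlgEquiv.ofInjective g hg
  refine ⟨h, hh, (e.symm : g.range →ₐ[k] L).comp
    ((IsScalarTower.toAlgHom k A N).codRestrict g.range hmem), ?_⟩
  exact e.symm.injective.comp ((AlgHom.injective_codRestrict _ _ _).2
    (FaithfulSMul.algebraMap_injective A N))

theorem IsUniruledAlgebra.exists_algHom {k A : Type} [Field k] [CommRing A] [Algebra k A]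
    [Algebra.FiniteType k A] (hA : IsUniruledAlgebra k A) :
    ∃ (B : Type) (_ : CommRing B) (_ : IsDomain B) (_ : Algebra k B) (_ : Algebra.FiniteType k B)
      (h : MvPolynomial (Fin 1) B), h ≠ 0 ∧
      Algebra.trdeg k B + 1 = Algebra.trdeg k A ∧
      ∃ φ : A →ₐ[k] Localization.Away h, Function.Injective φ := by
  obtain ⟨N, _, _, _, s, t, _, _, _, hs, hst, ht⟩ := hA
  let B := Algebra.adjoin k s
  have : Algebra.FiniteType k B := ⟨(Subalgebra.fg_top _).2 ⟨hs.toFinset, by simp [B]⟩⟩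
  let P := MvPolynomial (Fin 1) B
  let _ : Algebra P N := (MvPolynomial.aeval (R := B) (fun _ : Fin 1 => t)).toRingHom.toAlgebra
  have hP (p : P) : algebraMap P N p = MvPolynomial.aeval (fun _ => t) p := rfl
  have : IsScalarTower B P N := .of_algebraMap_eq fun b => by simp [hP, P]
  have : IsScalarTower k P N := .of_algebraMap_eq fun b => by
    rw [IsScalarTower.algebraMap_apply k B P, ← IsScalarTower.algebraMap_apply B P N]
    rfl
  have htB : Transcendental B t := by
    intro h
    let K := IntermediateField.adjoin k s
    let i : B →ₐ[k] K := Subalgebra.inclusion (IntermediateField.algebra_adjoin_le_adjoin k s)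
    let _ : Algebra B K := i.toRingHom.toAlgebra
    have : IsScalarTower B K N := .of_algebraMap_eq fun b => rfl
    exact ht (h.extendScalars (R := B) (S := K) (Subalgebra.inclusion_injective _))
  have : FaithfulSMul P N := (faithfulSMul_iff_algebraMap_injective _ _).2
    (algebraicIndependent_unique_type_iff.2 htB : AlgebraicIndependent B fun _ : Fin 1 => t)
  have hmem : ∀ x ∈ Algebra.adjoin k (insert t s), ∃ p : P, algebraMap P N p = x := by
    intro x hx
    refine Algebra.adjoin_le (S := (IsScalarTower.toAlgHom k P N).range) ?_ hx
    rintro x (rfl | hx)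
    · exact ⟨MvPolynomial.X 0, by simp [hP]⟩
    · exact ⟨MvPolynomial.C ⟨x, Algebra.subset_adjoin hx⟩, by simp [hP]⟩
  have hfrac (a : A) : ∃ p q : P, q ≠ 0 ∧
      algebraMap P N q * algebraMap A N a = algebraMap P N p := by
    obtain ⟨x, hx, y, hy, hxy⟩ := IntermediateField.mem_adjoin_iff_div.1 (hst a)
    obtain ⟨p, rfl⟩ := hmem x hx
    obtain ⟨q, rfl⟩ := hmem y hy
    rcases eq_or_ne q 0 with rfl | hq
    · exact ⟨0, 1, one_ne_zero, by simp [hxy]⟩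
    · refine ⟨p, q, hq, ?_⟩
      rw [hxy, mul_div_cancel₀]
      simpa using hq
  obtain ⟨h, hh, φ, hφ⟩ := exists_algHom_of_fraction (k := k) hfrac
  refine ⟨B, inferInstance, inferInstance, inferInstance, inferInstance, h, hh, ?_, φ, hφ⟩
  have : Algebra.IsAlgebraic P N := ⟨fun x => by
    refine isAlgebraic_of_forall_isAlgebraic (F := A) (fun a => ?_)
      (Algebra.IsAlgebraic.isAlgebraic x)
    obtain ⟨p, q, hq, hpq⟩ := hfrac a
    have hq' : algebraMap P N q ≠ 0 := by simpa using hq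
    rw [eq_div_of_mul_eq hq' ((mul_comm _ _).trans hpq), div_eq_mul_inv]
    exact (isAlgebraic_algebraMap _).mul (isAlgebraic_algebraMap _).inv⟩
  rw [← trdeg_mvPolynomial_fin_one, trdeg_eq_of_isAlgebraic k P N, trdeg_eq_of_isAlgebraic k A N]

theorem IsUniruledAlgebra.isUniruled {k : Type} [Field k] {X : Scheme} [IsIntegral X]
    {sX : X ⟶ Spec (CommRingCat.of k)} [LocallyOfFiniteType sX] {A : Type}
    [CommRing A] [Nontrivial A] [Algebra k A] (hA : IsUniruledAlgebra k A)
    (j : Spec (CommRingCat.of A) ⟶ X) [IsOpenImmersion j]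
    (hj : j ≫ sX = Spec.map (CommRingCat.ofHom (algebraMap k A))) : IsUniruled sX := by
  have := isDomain_of_isOpenImmersion j
  have := finiteType_of_isOpenImmersion j hj
  obtain ⟨B, _, _, _, _, h, hh, hdim, φ, hφ⟩ := hA.exists_algHom (k := k)
  let sW := Spec.map (CommRingCat.ofHom (algebraMap k B))
  have hsW : LocallyOfFiniteType sW := (HasRingHomProperty.Spec_iff (P := @LocallyOfFiniteType)).2
    (RingHom.finiteType_algebraMap.2 inferInstance)
  have hW : IsIntegral (Spec (CommRingCat.of B)) := inferInstance
  have hid : 𝟙 _ ≫ sW = Spec.map (CommRingCat.ofHom (algebraMap k B)) := Category.id_comp _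
  obtain ⟨i, _, hi⟩ := exists_chart_pullback_affineSpace (𝟙 _) hid
  have := isIntegral_pullback_affineSpace sW
  have hpow := powers_le_nonZeroDivisors_of_noZeroDivisors hh
  have : IsDomain (Localization.Away h) := IsLocalization.isDomain_localization hpow
  let c := Spec.map (CommRingCat.ofHom (algebraMap _ (Localization.Away h))) ≫ i
  have hc : c ≫ pullback.fst _ _ ≫ sW =
      Spec.map (CommRingCat.ofHom (algebraMap k (Localization.Away h))) := by
    simp only [c, Category.assoc]
    rw [hi, ← Spec.map_comp, ← CommRingCat.ofHom_comp, ← IsScalarTower.algebraMap_eq]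
  refine ⟨_, sW, hW, hsW, ?_, ⟨c.opensRange, denseRange_of_isOpenImmersion c,
    c.isoOpensRange.inv ≫ Spec.map (CommRingCat.ofHom φ.toRingHom) ≫ j⟩, ?_, ?_⟩
  · obtain ⟨n, hn, hn'⟩ := exists_trdeg_eq_and_topologicalKrullDim_eq j hj
    obtain ⟨m, hm, hm'⟩ := exists_trdeg_eq_and_topologicalKrullDim_eq (𝟙 _) hid
    rw [hm', hn']
    rw [hm, hn] at hdim
    exact_mod_cast hdim
  · have h1 : DenseRange (Spec.map (CommRingCat.ofHom φ.toRingHom)) :=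
      (PrimeSpectrum.denseRange_comap_iff_ker_le_nilRadical φ.toRingHom).2
        (((RingHom.injective_iff_ker_eq_bot φ.toRingHom).1 hφ).le.trans bot_le)
    have h2 : DenseRange c.isoOpensRange.inv := c.isoOpensRange.inv.surjective.denseRange
    exact (denseRange_of_isOpenImmersion j).comp (h1.comp h2 (Scheme.Hom.continuous _))
      (Scheme.Hom.continuous _)
  · change (c.isoOpensRange.inv ≫ _ ≫ _) ≫ sX = c.opensRange.ι ≫ _
    rw [← Scheme.Hom.isoOpensRange_inv_comp]
    simp only [Category.assoc]
    rw [hc, hj, ← Spec.map_comp, ← CommRingCat.ofHom_comp]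
    congr 3
    exact φ.comp_algebraMap

theorem exists_chart_geometricGenericPoint {k : Type} [Field k] (T : Scheme) [IsIntegral T]
    (sT : T ⟶ Spec (CommRingCat.of k)) :
    ∃ (R : Type) (_ : CommRing R) (_ : Algebra k R)
      (_ : Algebra R (AlgebraicClosure (T.residueField (genericPoint T))))
      (j : Spec (CommRingCat.of R) ⟶ T),
      Nontrivial R ∧ IsOpenImmersion j ∧
      FaithfulSMul R (AlgebraicClosure (T.residueField (genericPoint T))) ∧
      Algebra.IsAlgebraic R (AlgebraicClosure (T.residueField (genericPoint T))) ∧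
      j ≫ sT = Spec.map (CommRingCat.ofHom (algebraMap k R)) ∧
      Spec.map (CommRingCat.ofHom
        (algebraMap R (AlgebraicClosure (T.residueField (genericPoint T))))) ≫ j =
          geometricGenericPoint T := by
  obtain ⟨U, hU, hη, -⟩ := exists_isAffineOpen_mem_and_subset
    (TopologicalSpace.Opens.mem_top (genericPoint T))
  have : Nonempty U := ⟨⟨_, hη⟩⟩
  have hfrac := functionField_isFractionRing_of_isAffineOpen T U hU
  let ψ : Γ(T, U) ⟶ T.residueField (genericPoint T) :=
    T.presheaf.germ U _ hη ≫ T.residue (genericPoint T)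
  let _algκ : Algebra Γ(T, U) (T.residueField (genericPoint T)) := ψ.hom.toAlgebra
  let ρ : T.functionField →+* T.residueField (genericPoint T) :=
    (T.residue (genericPoint T)).hom
  have hρ : ∀ r : Γ(T, U), ρ (algebraMap Γ(T, U) T.functionField r) =
    algebraMap Γ(T, U) (T.residueField (genericPoint T)) r := fun _ => rfl
  have hinj : Function.Injective (algebraMap Γ(T, U) (T.residueField (genericPoint T))) := by
    intro a b h
    rw [← hρ, ← hρ] at h
    exact IsFractionRing.injective Γ(T, U) T.functionField (ρ.injective h)
  have : FaithfulSMul Γ(T, U) (T.residueField (genericPoint T)) :=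
    (faithfulSMul_iff_algebraMap_injective _ _).2 hinj
  have halg : Algebra.IsAlgebraic Γ(T, U) (T.residueField (genericPoint T)) := by
    refine ⟨fun x => ?_⟩
    obtain ⟨y, rfl⟩ := T.residue_surjective _ x
    let ρ' : T.functionField →ₐ[Γ(T, U)] T.residueField (genericPoint T) :=
      { ρ with commutes' := hρ }
    have hy : IsAlgebraic Γ(T, U) (y : T.functionField) :=
      (IsLocalization.isAlgebraic T.functionField (nonZeroDivisors Γ(T, U))).isAlgebraic _
    exact hy.algHom ρ'
  refine ⟨Γ(T, U), inferInstance, (Spec.preimage (hU.fromSpec ≫ sT)).hom.toAlgebra, inferInstance,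
    hU.fromSpec, inferInstance, inferInstance, ?_, ?_, ?_, ?_⟩
  · exact FaithfulSMul.trans Γ(T, U) (T.residueField (genericPoint T)) _
  · exact Algebra.IsAlgebraic.trans Γ(T, U) (T.residueField (genericPoint T)) _
  · rw [RingHom.algebraMap_toAlgebra, CommRingCat.ofHom_hom, Spec.map_preimage]
  · rw [geometricGenericPoint, Scheme.fromSpecResidueField, ← hU.fromSpecStalk_eq_fromSpecStalk hη,
      IsAffineOpen.fromSpecStalk, ← Spec.map_comp_assoc, ← Spec.map_comp_assoc,
      IsScalarTower.algebraMap_eq Γ(T, U) (T.residueField (genericPoint T))]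
    rfl

open TensorProduct in
theorem exists_chart_pullback_of_charts {R A Ω : Type} [CommRing R] [CommRing A] [Field Ω]
    [Algebra R A] [Algebra R Ω] {X T : Scheme} (f : X ⟶ T) (g : Spec (CommRingCat.of Ω) ⟶ T)
    (jT : Spec (CommRingCat.of R) ⟶ T) [IsOpenImmersion jT]
    (jX : Spec (CommRingCat.of A) ⟶ X) [IsOpenImmersion jX]
    (hf : Spec.map (CommRingCat.ofHom (algebraMap R A)) ≫ jT = jX ≫ f)
    (hg : Spec.map (CommRingCat.ofHom (algebraMap R Ω)) ≫ jT = g) :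
    ∃ c : Spec (CommRingCat.of (Ω ⊗[R] A)) ⟶ pullback f g, IsOpenImmersion c ∧
      c ≫ pullback.snd f g = Spec.map (CommRingCat.ofHom (algebraMap Ω (Ω ⊗[R] A))) := by
  refine ⟨(pullbackSpecIso R Ω A).inv ≫ (pullbackSymmetry _ _).hom ≫
    pullback.map _ _ f g jX (𝟙 _) jT hf (by simpa using hg), inferInstance, ?_⟩
  rw [Category.assoc, Category.assoc]
  erw [pullback.lift_snd]
  rw [Category.comp_id, pullbackSymmetry_hom_comp_snd, pullbackSpecIso_inv_fst']

open TensorProduct in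
theorem nontrivial_tensorProduct_of_apply_eq {R A Ω : Type} [CommRing R] [CommRing A] [CommRing Ω]
    [Algebra R A] [Algebra R Ω] (a : Spec (CommRingCat.of A)) (ω : Spec (CommRingCat.of Ω))
    (h : Spec.map (CommRingCat.ofHom (algebraMap R Ω)) ω =
      Spec.map (CommRingCat.ofHom (algebraMap R A)) a) : Nontrivial (Ω ⊗[R] A) := by
  obtain ⟨z, -⟩ := Scheme.Pullback.exists_preimage_pullback ω a h
  exact PrimeSpectrum.nontrivial (R := Ω ⊗[R] A) ((pullbackSpecIso R Ω A).hom z)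

/-- Let `f : X → T` be a surjective projective (here: proper) morphism of
varieties over an uncountable algebraically closed field `k`, such that `T` is not uniruled
and the geometric generic fiber `X ×_T Spec K(T)^{alg}` of `f` is integral. If `X` is
uniruled, then the geometric generic fiber of `f` is uniruled (over `Spec K(T)^{alg}`). -/
theorem uniruled_geometric_generic_fiber
    (k : Type) [Field k] [IsAlgClosed k] [Uncountable k]
    (X T : Scheme) [IsIntegral X] [IsIntegral T]
    (sX : X ⟶ Spec (CommRingCat.of k)) (sT : T ⟶ Spec (CommRingCat.of k))
    [LocallyOfFiniteType sX] [LocallyOfFiniteType sT]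
    [QuasiCompact sX] [QuasiCompact sT]
    (f : X ⟶ T) (hcomp : f ≫ sT = sX) [IsProper f]
    (hsurj : Function.Surjective f.base)
    (hT : ¬ IsUniruled sT)
    (hfib : IsIntegral (pullback f (geometricGenericPoint T)))
    (hX : IsUniruled sX) :
    IsUniruled (pullback.snd f (geometricGenericPoint T)) := by
  obtain ⟨R, _, _, _, jT, _, _, _, _, hjT, hg⟩ := exists_chart_geometricGenericPoint T sT
  obtain ⟨x, hx⟩ := hsurj (genericPoint T)
  let Ω := AlgebraicClosure (T.residueField (genericPoint T))
  obtain ⟨ω⟩ : Nonempty (Spec (CommRingCat.of Ω)) := inferInstance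
  have hω : jT (Spec.map (CommRingCat.ofHom (algebraMap R Ω)) ω) = genericPoint T := by
    rw [← Scheme.Hom.comp_apply, hg, geometricGenericPoint, Scheme.Hom.comp_apply]
    exact Scheme.fromSpecResidueField_apply _ _
  have hxO : x ∈ f ⁻¹ᵁ jT.opensRange := ⟨_, hω.trans hx.symm⟩
  obtain ⟨A, _, _, jX, _, _, ⟨a, rfl⟩, hrange, hjX⟩ := exists_chart_of_mem sX hxO
  have hlift : Set.range (jX ≫ f) ⊆ Set.range jT := by
    rintro _ ⟨y, rfl⟩
    exact hrange ⟨y, rfl⟩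
  obtain ⟨ψ, hψ⟩ := Spec.map_surjective (IsOpenImmersion.lift jT (jX ≫ f) hlift)
  let : Algebra R A := ψ.hom.toAlgebra
  have hf : Spec.map (CommRingCat.ofHom (algebraMap R A)) ≫ jT = jX ≫ f := by
    rw [RingHom.algebraMap_toAlgebra, CommRingCat.ofHom_hom, hψ, IsOpenImmersion.lift_fac]
  have : IsScalarTower k R A := by
    refine IsScalarTower.of_algebraMap_eq' (congr_arg CommRingCat.Hom.hom
      (Spec.map_injective (a₁ := CommRingCat.ofHom (algebraMap k A))
        (a₂ := CommRingCat.ofHom ((algebraMap R A).comp (algebraMap k R))) ?_))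
    rw [← hjX, CommRingCat.ofHom_comp, Spec.map_comp, ← hjT, ← hcomp, reassoc_of% hf]
  have := isDomain_of_isOpenImmersion jX
  have := isDomain_of_isOpenImmersion jT
  have := finiteType_of_isOpenImmersion jT hjT
  have : FaithfulSMul R A := by
    refine (faithfulSMul_iff_algebraMap_injective R A).2 (injective_of_denseRange_specMap _
      (denseRange_of_comp_isOpenImmersion _ jT ?_))
    rw [hf, show ⇑(jX ≫ f) = f ∘ jX from funext fun z => Scheme.Hom.comp_apply jX f z]
    exact hsurj.denseRange.comp (denseRange_of_isOpenImmersion jX) f.continuous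
  obtain ⟨c, _, hc⟩ := exists_chart_pullback_of_charts f _ jT jX hf hg
  have := nontrivial_tensorProduct_of_apply_eq (R := R) a ω (jT.isOpenEmbedding.injective (by
    rw [hω, ← Scheme.Hom.comp_apply, hf]
    exact hx.symm))
  have := isDomain_of_isOpenImmersion c
  have : Infinite k := inferInstance
  rcases (hX.isUniruledAlgebra jX hjX).or_tensorProduct (R := R) (Ω := Ω) with h | h
  · exact absurd (h.isUniruled jT hjT) hT
  · exact h.isUniruled c hc
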